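/- arXiv:2001.11176 — 4 statements merged into one kernel-verified Lean document; each statement's English description precedes it below -/
import Mathlib

section
/- Let $v_0 \geq 0$, $v_{\max} > 0$ with $v_0 + 2 v_{\max} > 0$, $S > 0$, and set $t_f = \frac{3 S}{v_0 + 2 v_{\max}}$. Then $t_f > 0$, and the optimal cubic trajectory with coefficients $d = 0$, $c = v_0$, $b = 3(S - v_0 t_f)/(2 t_f^2)$, $a = -b/(3 t_f)$ satisfies the terminal speed condition $v(t_f) = 3 a t_f^2 + 2 b t_f + v_0 = v_{\max}$. Conversely, if $t_f > 0$ and $v(t_f) = v_{\max}$ for this trajectory, then $t_f = \frac{3 S}{v_0 + 2 v_{\max}}$. -/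
/-- `t_f = 3S/(v₀ + 2 v_max)` is positive and is exactly the exit
time at which the optimal cubic trajectory's terminal speed equals `v_max`. -/
theorem stmt_6 (v0 vmax S : ℝ) (hv0 : 0 ≤ v0) (hvmax : 0 < vmax)
    (hsum : 0 < v0 + 2 * vmax) (hS : 0 < S) :
    (let tf : ℝ := 3 * S / (v0 + 2 * vmax)
     let b : ℝ := 3 * (S - v0 * tf) / (2 * tf ^ 2)
     let a : ℝ := -b / (3 * tf)
     0 < tf ∧ 3 * a * tf ^ 2 + 2 * b * tf + v0 = vmax) ∧
    ∀ tf : ℝ, 0 < tf →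
      (let b : ℝ := 3 * (S - v0 * tf) / (2 * tf ^ 2)
       let a : ℝ := -b / (3 * tf)
       3 * a * tf ^ 2 + 2 * b * tf + v0 = vmax) →
      tf = 3 * S / (v0 + 2 * vmax) := by
  have key : ∀ tf : ℝ, 0 < tf →
      3 * (-(3 * (S - v0 * tf) / (2 * tf ^ 2)) / (3 * tf)) * tf ^ 2
        + 2 * (3 * (S - v0 * tf) / (2 * tf ^ 2)) * tf + v0 = (3 * S - v0 * tf) / (2 * tf) := by
    intro tf h
    have h0 : tf ≠ 0 := h.ne'
    field_simp
    ring
  refine ⟨?_, ?_⟩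
  · intro tf b a
    have h : 0 < tf := by positivity
    refine ⟨h, (key tf h).trans ?_⟩
    have e : tf * (v0 + 2 * vmax) = 3 * S := div_mul_cancel₀ _ hsum.ne'
    rw [div_eq_iff (by positivity)]
    linarith
  · intro tf h hv
    have e := (key tf h).symm.trans hv
    rw [div_eq_iff (by positivity)] at e
    rw [eq_div_iff hsum.ne']
    linarith
end

section
/- Let $t_f > 0$, $v_0, S \in \mathbb{R}$, and consider the optimal cubic trajectory with coefficients $d=0$, $c=v_0$, $b = 3(S - v_0 t_f)/(2 t_f^2)$, $a = -b/(3 t_f)$, whose speed is $v(t) = 3 a t^2 + 2 b t + v_0$. Then $v$ is monotone on $[0, t_f]$: if $b \geq 0$ (equivalently $S \geq v_0 t_f$) then $v$ is nondecreasing on $[0, t_f]$, and if $b \leq 0$ then $v$ is nonincreasing on $[0, t_f]$. In particular, for all $t \in [0, t_f]$, $v(t)$ lies between $v(0) = v_0$ and $v(t_f)$. -/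
/-- the speed `v(t) = 3 a t² + 2 b t + v₀` of the optimal cubic
trajectory is monotone on `[0, t_f]`: nondecreasing when `b ≥ 0` (equivalently
`S ≥ v₀ t_f`) and nonincreasing when `b ≤ 0`; in particular `v(t)` always lies
between `v(0) = v₀` and `v(t_f)`. -/
theorem stmt_12 (tf v0 S a b c d : ℝ) (htf : 0 < tf)
    (hd : d = 0) (hc : c = v0)
    (hb : b = 3 * (S - v0 * tf) / (2 * tf ^ 2))
    (ha : a = -b / (3 * tf)) :
    (0 ≤ b ↔ v0 * tf ≤ S) ∧
    (0 ≤ b → MonotoneOn (fun t => 3 * a * t ^ 2 + 2 * b * t + v0) (Set.Icc 0 tf)) ∧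
    (b ≤ 0 → AntitoneOn (fun t => 3 * a * t ^ 2 + 2 * b * t + v0) (Set.Icc 0 tf)) ∧
    (∀ t ∈ Set.Icc (0 : ℝ) tf,
      min v0 (3 * a * tf ^ 2 + 2 * b * tf + v0) ≤ 3 * a * t ^ 2 + 2 * b * t + v0 ∧
      3 * a * t ^ 2 + 2 * b * t + v0 ≤ max v0 (3 * a * tf ^ 2 + 2 * b * tf + v0)) := by
  have hbk : b = -(3 * a) * tf := by
    rw [ha]; field_simp
  have key : ∀ x y : ℝ, (3 * a * y ^ 2 + 2 * b * y + v0) - (3 * a * x ^ 2 + 2 * b * x + v0)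
      = -(3 * a) * ((y - x) * (2 * tf - x - y)) := by
    intro x y; rw [hbk]; ring
  have hm : 0 ≤ b → MonotoneOn (fun t => 3 * a * t ^ 2 + 2 * b * t + v0) (Set.Icc 0 tf) := by
    intro h x hx y hy hxy
    have h1 : 0 ≤ -(3 * a) := by
      rw [hbk] at h
      exact nonneg_of_mul_nonneg_left h htf
    have h2 : 0 ≤ (y - x) * (2 * tf - x - y) :=
      mul_nonneg (by linarith) (by linarith [hx.2, hy.2])
    have h3 := mul_nonneg h1 h2
    have h4 := key x y
    show 3 * a * x ^ 2 + 2 * b * x + v0 ≤ 3 * a * y ^ 2 + 2 * b * y + v0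
    linarith
  have hn : b ≤ 0 → AntitoneOn (fun t => 3 * a * t ^ 2 + 2 * b * t + v0) (Set.Icc 0 tf) := by
    intro h x hx y hy hxy
    have h1 : 0 ≤ 3 * a := by
      apply nonneg_of_mul_nonneg_left (b := tf) _ htf
      linarith
    have h2 : 0 ≤ (y - x) * (2 * tf - x - y) :=
      mul_nonneg (by linarith) (by linarith [hx.2, hy.2])
    have h3 := mul_nonneg h1 h2
    have h4 := key x y
    show 3 * a * y ^ 2 + 2 * b * y + v0 ≤ 3 * a * x ^ 2 + 2 * b * x + v0
    linarith
  refine ⟨?_, hm, hn, ?_⟩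
  · have hp : 0 < 2 * tf ^ 2 := by positivity
    rw [hb, le_div_iff₀ hp]
    constructor <;> intro h <;> linarith
  · intro t ht
    have m0 : (0 : ℝ) ∈ Set.Icc 0 tf := ⟨le_refl _, htf.le⟩
    have m1 : tf ∈ Set.Icc 0 tf := ⟨htf.le, le_refl _⟩
    rcases le_total 0 b with h | h
    · have e1 := hm h m0 ht ht.1
      have e2 := hm h ht m1 ht.2
      simp only at e1 e2
      exact ⟨(min_le_left _ _).trans (by linarith), e2.trans (le_max_right _ _)⟩
    · have e1 := hn h m0 ht ht.1
      have e2 := hn h ht m1 ht.2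
      simp only at e1 e2
      exact ⟨(min_le_right _ _).trans e2, le_trans (by linarith) (le_max_left _ _)⟩
end

section
/- Let $v_0 > 0$, $S > 0$, and $u_{\max} > 0$. Define $t_{u_{\max}} = \big(\sqrt{9 v_0^2 + 12 S u_{\max}} - 3 v_0\big)/(2 u_{\max})$. For every $t_f \geq t_{u_{\max}}$, the optimal cubic trajectory with coefficients $d=0$, $c=v_0$, $b = 3(S - v_0 t_f)/(2 t_f^2)$, $a = -b/(3 t_f)$ has entry control input $u(0) = 2b = \frac{3(S - v_0 t_f)}{t_f^2} \leq u_{\max}$. -/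
/-- for every exit time
`t_f ≥ t_{u_max} = (√(9 v₀² + 12 S u_max) - 3 v₀)/(2 u_max)`, the optimal cubic
trajectory has entry control input `u(0) = 2b = 3(S - v₀ t_f)/t_f² ≤ u_max`. -/
theorem stmt_17 (v0 S umax : ℝ) (hv0 : 0 < v0) (hS : 0 < S) (humax : 0 < umax) :
    ∀ tf : ℝ,
      (Real.sqrt (9 * v0 ^ 2 + 12 * S * umax) - 3 * v0) / (2 * umax) ≤ tf →
      (let b : ℝ := 3 * (S - v0 * tf) / (2 * tf ^ 2)
       2 * b = 3 * (S - v0 * tf) / tf ^ 2 ∧ 2 * b ≤ umax) := by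
  intro tf h b
  have hP : 0 < S * umax := mul_pos hS humax
  have hsq : Real.sqrt (9 * v0 ^ 2 + 12 * S * umax) ^ 2 = 9 * v0 ^ 2 + 12 * S * umax :=
    Real.sq_sqrt (by nlinarith [sq_nonneg v0])
  have hgt : 3 * v0 < Real.sqrt (9 * v0 ^ 2 + 12 * S * umax) :=
    Real.lt_sqrt_of_sq_lt (by nlinarith)
  have htf : 0 < tf :=
    lt_of_lt_of_le (div_pos (by linarith) (by linarith)) h
  rw [div_le_iff₀ (by linarith)] at h
  have hb : 2 * b = 3 * (S - v0 * tf) / tf ^ 2 := by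
    simp only [b]
    field_simp
  refine ⟨hb, ?_⟩
  rw [hb, div_le_iff₀ (by positivity)]
  have h1 : Real.sqrt (9 * v0 ^ 2 + 12 * S * umax) ≤ tf * (2 * umax) + 3 * v0 := by linarith
  have h2 := pow_le_pow_left₀ (Real.sqrt_nonneg _) h1 2
  rw [hsq] at h2
  have h3 : umax * (3 * (S - v0 * tf)) ≤ umax * (umax * tf ^ 2) := by nlinarith
  exact le_of_mul_le_mul_left h3 humax
end

section
/- Let $v_0 > 0$, $S > 0$, $u_{\max} > 0$, and $v_{\max} > 0$. Define $t_{u_{\max}} = \big(\sqrt{9 v_0^2 + 12 S u_{\max}} - 3 v_0\big)/(2 u_{\max})$, $t_{v_{\max}} = 3S/(v_0 + 2 v_{\max})$, and $t_{\min}^f = \min\{t_{u_{\max}}, t_{v_{\max}}\}$. Then for every exit time $t_f \geq t_{\min}^f$ such that also $t_f \geq t_{u_{\max}}$ and $t_f \geq t_{v_{\max}}$, the optimal cubic trajectory with coefficients $d=0$, $c=v_0$, $b = 3(S - v_0 t_f)/(2 t_f^2)$, $a = -b/(3 t_f)$ simultaneously satisfies $u(0) \leq u_{\max}$ and $v(t_f)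 \leq v_{\max}$. -/
/-- for every exit time `t_f` at least
`t_min = min{t_{u_max}, t_{v_max}}` with `t_f ≥ t_{u_max}` and `t_f ≥ t_{v_max}`,
the optimal cubic trajectory simultaneously satisfies the entry acceleration
bound `u(0) ≤ u_max` and the exit speed bound `v(t_f) ≤ v_max`. -/
theorem stmt_19 (v0 S umax vmax : ℝ) (hv0 : 0 < v0) (hS : 0 < S)
    (humax : 0 < umax) (hvmax : 0 < vmax) :
    ∀ tf : ℝ,
      min ((Real.sqrt (9 * v0 ^ 2 + 12 * S * umax) - 3 * v0) / (2 * umax))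
          (3 * S / (v0 + 2 * vmax)) ≤ tf →
      (Real.sqrt (9 * v0 ^ 2 + 12 * S * umax) - 3 * v0) / (2 * umax) ≤ tf →
      3 * S / (v0 + 2 * vmax) ≤ tf →
      (let b : ℝ := 3 * (S - v0 * tf) / (2 * tf ^ 2)
       let a : ℝ := -b / (3 * tf)
       6 * a * 0 + 2 * b ≤ umax ∧ 3 * a * tf ^ 2 + 2 * b * tf + v0 ≤ vmax) := by
  intro tf _ h1 h2
  have hD : 0 < v0 + 2 * vmax := by positivity
  have ht : 0 < tf := lt_of_lt_of_le (by positivity) h2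
  rw [div_le_iff₀ hD] at h2
  rw [div_le_iff₀ (by positivity)] at h1
  have h3 : Real.sqrt (9 * v0 ^ 2 + 12 * S * umax) ≤ 2 * umax * tf + 3 * v0 := by linarith
  rw [Real.sqrt_le_left (by positivity)] at h3
  have h4 : 3 * (S - v0 * tf) ≤ umax * tf ^ 2 := by
    have : umax * (3 * (S - v0 * tf)) ≤ umax * (umax * tf ^ 2) := by nlinarith
    exact le_of_mul_le_mul_left this humax
  intro b a
  constructor
  · have : 6 * a * 0 + 2 * b = 3 * (S - v0 * tf) / tf ^ 2 := by
      simp only [b]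
      field_simp
      ring
    rw [this, div_le_iff₀ (by positivity)]
    exact h4
  · have : 3 * a * tf ^ 2 + 2 * b * tf + v0 = (3 * S - v0 * tf) / (2 * tf) := by
      simp only [a, b]
      field_simp
      ring
    rw [this, div_le_iff₀ (by positivity)]
    linarith
end
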